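/- Let S⁰ be an inverse semigroup with semilattice of idempotents E⁰, L a left inverse semigroup and R a right inverse semigroup such that S⁰ is a quasi-ideal inverse transversal of both L and R, and let ∗ : R × L → S⁰ satisfy: (1) for all y, z ∈ L and a, b ∈ R with y⁰ = b⁰, ((a∗y)(b⁰b))∗z = a∗((yy⁰)(b∗z)); (2) a∗x = ax whenever a ∈ S⁰ or x ∈ S⁰. Then T = {(x,a) ∈ L × R : x⁰ = a⁰} with multiplication (x,a)(y,b) = ((xx⁰)(a∗y), (a∗y)(b⁰b)) is a regular semigroup and T⁰ = {(s,s) : s ∈ S⁰} is a quasi-ideal inverse transversal of T isomorphic to S⁰. Conversely, every regular semigroup with a quasi-ideal inverse transversal arises this way: if S is regular with quasi-ideal inverse transversal S⁰, then with L = {x ∈ S : x⁰x ∈ E⁰}, R = {x ∈ S : xx⁰ ∈ E⁰} and a∗x = ax, conditions (1) and (2) hold and S is isomorphic to the resulting T. -/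

import Mathlib

/-!
Common framework: "relative" semigroup-theoretic notions.  All notions are taken
relative to a carrier set `U` inside an ambient type, together with an explicit
binary operation `mul` (only the values of `mul` on `U` are relevant).  For an
honest semigroup `S` one takes `U = Set.univ` and `mul = mulOf S`.

* `RStarOn mul U a b` : the relation `a ℛ* b` computed in `U` with an identity
  adjoined (the two clauses correspond to multipliers from `U` and to the
  adjoined identity).
* `LStarOn`, `GreenLOn`, `GreenROn` : dual / Green's relations.
* `AbundantOn`, `AdequateOn`, `LeftAdequateOn`, `RightAdequateOn`.
* `AdequateTransversalOn mul U S0` : `S0` is an adequate `*`-subsemigroup of `U`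
  which is an adequate transversal, with the data `bar x = x̄`, `e x = e_x`,
  `f x = f_x`, and `plus s = s⁺`, `star s = s⋆` for `s ∈ S0`.
* `InverseTransversalOn mul U S0` : `S0` is an inverse transversal of the
  regular semigroup `U`, with `o x = x⁰` the unique inverse of `x` in `S0`.
-/

namespace Paper

universe u

variable {α : Type*} {β : Type*} {γ : Type*}

def mulOf (α : Type*) [Mul α] : α → α → α := fun a b => a * b

/-- `x` is an idempotent for the operation `mul`. -/
def Idem (mul : α → α → α) (x : α) : Prop := mul x x = x

/-- The relation `ℛ*` on `U` (with an identity adjoined to `U`). -/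
def RStarOn (mul : α → α → α) (U : Set α) (a b : α) : Prop :=
  (∀ x ∈ U, ∀ y ∈ U, (mul x a = mul y a ↔ mul x b = mul y b)) ∧
  (∀ x ∈ U, (mul x a = a ↔ mul x b = b))

/-- The relation `ℒ*` on `U` (with an identity adjoined to `U`). -/
def LStarOn (mul : α → α → α) (U : Set α) (a b : α) : Prop :=
  (∀ x ∈ U, ∀ y ∈ U, (mul a x = mul a y ↔ mul b x = mul b y)) ∧
  (∀ x ∈ U, (mul a x = a ↔ mul b x = b))

/-- Green's relation `ℒ` on `U`: `U¹ a = U¹ b`. -/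
def GreenLOn (mul : α → α → α) (U : Set α) (a b : α) : Prop :=
  (a = b ∨ ∃ u ∈ U, mul u b = a) ∧ (b = a ∨ ∃ v ∈ U, mul v a = b)

/-- Green's relation `ℛ` on `U`: `a U¹ = b U¹`. -/
def GreenROn (mul : α → α → α) (U : Set α) (a b : α) : Prop :=
  (a = b ∨ ∃ u ∈ U, mul b u = a) ∧ (b = a ∨ ∃ v ∈ U, mul a v = b)

/-- `U` is closed under `mul`. -/
def ClosedOn (mul : α → α → α) (U : Set α) : Prop :=
  ∀ a ∈ U, ∀ b ∈ U, mul a b ∈ U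

/-- `U` with the operation `mul` is a semigroup. -/
def SemigroupOn (mul : α → α → α) (U : Set α) : Prop :=
  ClosedOn mul U ∧ ∀ a ∈ U, ∀ b ∈ U, ∀ c ∈ U, mul (mul a b) c = mul a (mul b c)

/-- Every `ℛ*`-class and every `ℒ*`-class of `U` contains an idempotent. -/
def AbundantOn (mul : α → α → α) (U : Set α) : Prop :=
  ∀ a ∈ U, (∃ e ∈ U, Idem mul e ∧ RStarOn mul U a e) ∧
           (∃ f ∈ U, Idem mul f ∧ LStarOn mul U a f)

/-- Abundant with commuting idempotents. -/
def AdequateOn (mul : α → α → α) (U : Set α) : Prop :=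
  AbundantOn mul U ∧
    ∀ u ∈ U, ∀ v ∈ U, Idem mul u → Idem mul v → mul u v = mul v u

/-- Abundant, and every `ℛ*`-class contains a unique idempotent. -/
def LeftAdequateOn (mul : α → α → α) (U : Set α) : Prop :=
  AbundantOn mul U ∧
    ∀ u ∈ U, ∀ v ∈ U, Idem mul u → Idem mul v → RStarOn mul U u v → u = v

/-- Abundant, and every `ℒ*`-class contains a unique idempotent. -/
def RightAdequateOn (mul : α → α → α) (U : Set α) : Prop :=
  AbundantOn mul U ∧
    ∀ u ∈ U, ∀ v ∈ U, Idem mul u → Idem mul v → LStarOn mul U u v → u = v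

/-- `S0` is a quasi-ideal of `U` : `S0 U S0 ⊆ S0`. -/
def QuasiIdealOn (mul : α → α → α) (U S0 : Set α) : Prop :=
  ∀ s ∈ S0, ∀ x ∈ U, ∀ t ∈ S0, mul (mul s x) t ∈ S0

/-- Every element of `U` has an inverse in `U`. -/
def RegularOn (mul : α → α → α) (U : Set α) : Prop :=
  ∀ x ∈ U, ∃ u ∈ U, mul (mul x u) x = x ∧ mul (mul u x) u = u

/-- Regular with commuting idempotents, i.e. an inverse semigroup. -/
def InverseSgpOn (mul : α → α → α) (U : Set α) : Prop :=
  RegularOn mul U ∧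
    ∀ u ∈ U, ∀ v ∈ U, Idem mul u → Idem mul v → mul u v = mul v u

/-- Regular, and every Green `ℛ`-class contains a unique idempotent. -/
def LeftInverseSgpOn (mul : α → α → α) (U : Set α) : Prop :=
  RegularOn mul U ∧
    ∀ u ∈ U, ∀ v ∈ U, Idem mul u → Idem mul v → GreenROn mul U u v → u = v

/-- Regular, and every Green `ℒ`-class contains a unique idempotent. -/
def RightInverseSgpOn (mul : α → α → α) (U : Set α) : Prop :=
  RegularOn mul U ∧
    ∀ u ∈ U, ∀ v ∈ U, Idem mul u → Idem mul v → GreenLOn mul U u v → u = v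

/-- An isomorphism from `(A, mulA)` onto `(B, mulB)`. -/
def IsoOn (mulA : α → α → α) (mulB : β → β → β) (A : Set α) (B : Set β) : Prop :=
  ∃ θ : α → β, Set.BijOn θ A B ∧ ∀ a ∈ A, ∀ b ∈ A, θ (mulA a b) = mulB (θ a) (θ b)

/-- `S0` is an adequate transversal of the abundant semigroup `U`.  `S0` is an
adequate `*`-subsemigroup of `U` (witnessed by `plus`/`star`, the canonical
idempotents `a⁺ ℛ* a`, `a⋆ ℒ* a` of elements of `S0`, the `ℛ*`/`ℒ*` relations
being those of the big semigroup `U`, which gives the `*`-subsemigroup property),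
and every `x ∈ U` factors uniquely as `x = e_x x̄ f_x` with `x̄ ∈ S0`,
`e_x, f_x` idempotents of `U`, `e_x ℒ x̄⁺` and `f_x ℛ x̄⋆`. -/
structure AdequateTransversalOn (mul : α → α → α) (U S0 : Set α) where
  sub : S0 ⊆ U
  mul_mem : ∀ a ∈ S0, ∀ b ∈ S0, mul a b ∈ S0
  bar : α → α
  e : α → α
  f : α → α
  plus : α → α
  star : α → α
  plus_mem : ∀ a ∈ S0, plus a ∈ S0
  plus_idem : ∀ a ∈ S0, Idem mul (plus a)
  plus_rstar : ∀ a ∈ S0, RStarOn mul U a (plus a)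
  star_mem : ∀ a ∈ S0, star a ∈ S0
  star_idem : ∀ a ∈ S0, Idem mul (star a)
  star_lstar : ∀ a ∈ S0, LStarOn mul U a (star a)
  idem_comm : ∀ u ∈ S0, ∀ v ∈ S0, Idem mul u → Idem mul v → mul u v = mul v u
  bar_mem : ∀ x ∈ U, bar x ∈ S0
  e_mem : ∀ x ∈ U, e x ∈ U
  f_mem : ∀ x ∈ U, f x ∈ U
  e_idem : ∀ x ∈ U, Idem mul (e x)
  f_idem : ∀ x ∈ U, Idem mul (f x)
  decomp : ∀ x ∈ U, x = mul (mul (e x) (bar x)) (f x)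
  e_greenL : ∀ x ∈ U, GreenLOn mul U (e x) (plus (bar x))
  f_greenR : ∀ x ∈ U, GreenROn mul U (f x) (star (bar x))
  unique : ∀ x ∈ U, ∀ s ∈ S0, ∀ e' ∈ U, ∀ f' ∈ U, Idem mul e' → Idem mul f' →
      x = mul (mul e' s) f' → GreenLOn mul U e' (plus s) → GreenROn mul U f' (star s) →
      s = bar x ∧ e' = e x ∧ f' = f x

namespace AdequateTransversalOn

variable {mul : α → α → α} {U S0 : Set α}

/-- `R = {x ∈ U : e_x = e_{x̄}}`. -/
def Rset (T : AdequateTransversalOn mul U S0) : Set α :=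
  {x | x ∈ U ∧ T.e x = T.e (T.bar x)}

/-- `L = {x ∈ U : f_x = f_{x̄}}`. -/
def Lset (T : AdequateTransversalOn mul U S0) : Set α :=
  {x | x ∈ U ∧ T.f x = T.f (T.bar x)}

/-- `I = {e_x : x ∈ U}`. -/
def Iset (T : AdequateTransversalOn mul U S0) : Set α :=
  {y | ∃ x ∈ U, T.e x = y}

/-- `Λ = {f_x : x ∈ U}`. -/
def LamSet (T : AdequateTransversalOn mul U S0) : Set α :=
  {y | ∃ x ∈ U, T.f x = y}

/-- The transversal is multiplicative: `Λ I ⊆ E⁰`. -/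
def IsMultiplicative (T : AdequateTransversalOn mul U S0) : Prop :=
  ∀ l ∈ T.LamSet, ∀ i ∈ T.Iset, mul l i ∈ S0 ∧ Idem mul (mul l i)

end AdequateTransversalOn

/-- The spined product set `T = L |×| R ⊆ S × S` attached to an adequate
transversal of `S` (ambient carrier `U`). -/
def spSet {mul : α → α → α} {U S0 : Set α}
    (T : AdequateTransversalOn mul U S0) : Set (α × α) :=
  {p | p.1 ∈ T.Lset ∧ p.2 ∈ T.Rset ∧ T.bar p.1 = T.bar p.2}

/-- The multiplication `(x,a)(y,b) = (e_x(ay), (ay) f_b)` on the spined product. -/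
def spMul {mul : α → α → α} {U S0 : Set α}
    (T : AdequateTransversalOn mul U S0) : α × α → α × α → α × α :=
  fun p q => (mul (T.e p.1) (mul p.2 q.1), mul (mul p.2 q.1) (T.f q.2))

/-- The map `φ : S → T`, `x ↦ (e_x x̄, x̄ f_x)`. -/
def phiMap {mul : α → α → α} {U S0 : Set α}
    (T : AdequateTransversalOn mul U S0) : α → α × α :=
  fun x => (mul (T.e x) (T.bar x), mul (T.bar x) (T.f x))

/-- `T⁰ = {(s,s) : s ∈ S0}`. -/
def diagSet (S0 : Set α) : Set (α × α) := {p | ∃ s ∈ S0, p = (s, s)}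

/-- Abstract spined product `L |×| R` over a common transversal `S⁰` (a type `γ`
embedded into `L` and `R` by `jL`, `jR`). -/
def absTset {mulL : α → α → α} {mulR : β → β → β} {jL : γ → α} {jR : γ → β}
    (TL : AdequateTransversalOn mulL Set.univ (Set.range jL))
    (TR : AdequateTransversalOn mulR Set.univ (Set.range jR)) : Set (α × β) :=
  {p | ∃ s : γ, jL s = TL.bar p.1 ∧ jR s = TR.bar p.2}

/-- The multiplication `(x,a)(y,b) = (e_x(a∗y), (a∗y) f_b)`. -/
def absMul {mulL : α → α → α} {mulR : β → β → β} {jL : γ → α} {jR : γ → β}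
    (TL : AdequateTransversalOn mulL Set.univ (Set.range jL))
    (TR : AdequateTransversalOn mulR Set.univ (Set.range jR))
    (st : β → α → γ) : α × β → α × β → α × β :=
  fun p q => (mulL (TL.e p.1) (jL (st p.2 q.1)), mulR (jR (st p.2 q.1)) (TR.f q.2))

/-- `T⁰ = {(s,s) : s ∈ S⁰}` inside `L × R`, where `s` is viewed in `L` and in `R`. -/
def absT0 (jL : γ → α) (jR : γ → β) : Set (α × β) :=
  {p | ∃ s : γ, p = (jL s, jR s)}

/-- `S0` is an inverse transversal of the regular semigroup `U`: an inverse
subsemigroup meeting the set of inverses of each `x ∈ U` in exactly one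
element `o x = x⁰`. -/
structure InverseTransversalOn (mul : α → α → α) (U S0 : Set α) where
  sub : S0 ⊆ U
  mul_mem : ∀ a ∈ S0, ∀ b ∈ S0, mul a b ∈ S0
  o : α → α
  o_mem : ∀ x ∈ U, o x ∈ S0
  o_inv1 : ∀ x ∈ U, mul (mul x (o x)) x = x
  o_inv2 : ∀ x ∈ U, mul (mul (o x) x) (o x) = o x
  o_unique : ∀ x ∈ U, ∀ u ∈ S0, mul (mul x u) x = x → mul (mul u x) u = u → u = o x
  idem_comm : ∀ u ∈ S0, ∀ v ∈ S0, Idem mul u → Idem mul v → mul u v = mul v u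

namespace InverseTransversalOn

variable {mul : α → α → α} {U S0 : Set α}

/-- `L = {x ∈ U : x⁰x ∈ E⁰}`. -/
def LsetI (T : InverseTransversalOn mul U S0) : Set α :=
  {x | x ∈ U ∧ mul (T.o x) x ∈ S0 ∧ Idem mul (mul (T.o x) x)}

/-- `R = {x ∈ U : xx⁰ ∈ E⁰}`. -/
def RsetI (T : InverseTransversalOn mul U S0) : Set α :=
  {x | x ∈ U ∧ mul x (T.o x) ∈ S0 ∧ Idem mul (mul x (T.o x))}

end InverseTransversalOn

/-- Spined product set for an inverse transversal: `{(x,a) : x⁰ = a⁰}`. -/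
def invSpSet {mul : α → α → α} {U S0 : Set α}
    (T : InverseTransversalOn mul U S0) : Set (α × α) :=
  {p | p.1 ∈ T.LsetI ∧ p.2 ∈ T.RsetI ∧ T.o p.1 = T.o p.2}

/-- The multiplication `(x,a)(y,b) = ((xx⁰)(ay), (ay)(b⁰b))`. -/
def invSpMul {mul : α → α → α} {U S0 : Set α}
    (T : InverseTransversalOn mul U S0) : α × α → α × α → α × α :=
  fun p q => (mul (mul p.1 (T.o p.1)) (mul p.2 q.1),
              mul (mul p.2 q.1) (mul (T.o q.2) q.2))

/-- Abstract spined product for inverse transversals: `{(x,a) : x⁰ = a⁰}`. -/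
def invAbsTset {mulL : α → α → α} {mulR : β → β → β} {jL : γ → α} {jR : γ → β}
    (TL : InverseTransversalOn mulL Set.univ (Set.range jL))
    (TR : InverseTransversalOn mulR Set.univ (Set.range jR)) : Set (α × β) :=
  {p | ∃ s : γ, jL s = TL.o p.1 ∧ jR s = TR.o p.2}

/-- The multiplication `(x,a)(y,b) = ((xx⁰)(a∗y), (a∗y)(b⁰b))`. -/
def invAbsMul {mulL : α → α → α} {mulR : β → β → β} {jL : γ → α} {jR : γ → β}
    (TL : InverseTransversalOn mulL Set.univ (Set.range jL))
    (TR : InverseTransversalOn mulR Set.univ (Set.range jR))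
    (st : β → α → γ) : α × β → α × β → α × β :=
  fun p q => (mulL (mulL p.1 (TL.o p.1)) (jL (st p.2 q.1)),
              mulR (jR (st p.2 q.1)) (mulR (TR.o q.2) q.2))

/-- The multiplication `(e,x)(g,w) = (e(aa⁻¹), a)`, `a = x((x⁻¹x)g)w`, on `I × S⁰`
(Chen-style construction from a left normal band `I` with semilattice transversal
`E⁰ = E(S⁰)`; `σ` embeds idempotents of the inverse semigroup `γ` into the band
`β`, and `π : β → γ` is the semilattice-transversal map `e ↦ e⁰`). -/
def bandMul (mulB : β → β → β) (mulG : γ → γ → γ) (σ : γ → β) (π : β → γ)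
    (inv : γ → γ) (p q : β × γ) : β × γ :=
  let a := mulG (mulG p.2 (π (mulB (σ (mulG (inv p.2) p.2)) q.1))) q.2
  (mulB p.1 (σ (mulG a (inv a))), a)

/-- `T = {(e,x) : e⁰ = xx⁻¹}`. -/
def bandTset (mulG : γ → γ → γ) (π : β → γ) (inv : γ → γ) : Set (β × γ) :=
  {p | π p.1 = mulG p.2 (inv p.2)}

/-- `T⁰ = {(aa⁻¹, a) : a ∈ S⁰}` (with `aa⁻¹` viewed in the band via `σ`). -/
def bandT0 (mulG : γ → γ → γ) (σ : γ → β) (inv : γ → γ) : Set (β × γ) :=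
  {p | ∃ s : γ, p = (σ (mulG s (inv s)), s)}

end Paper

namespace Paper

namespace InverseTransversalOn

variable {S : Type*} [Semigroup S] {S0 : Set S}

lemma mul_o_mul (T : InverseTransversalOn (mulOf S) Set.univ S0) (x : S) :
    x * T.o x * x = x :=
  T.o_inv1 x trivial

lemma o_mul_o (T : InverseTransversalOn (mulOf S) Set.univ S0) (x : S) :
    T.o x * x * T.o x = T.o x :=
  T.o_inv2 x trivial

lemma o_mem' (T : InverseTransversalOn (mulOf S) Set.univ S0) (x : S) : T.o x ∈ S0 :=
  T.o_mem x trivial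

lemma mul_mem' (T : InverseTransversalOn (mulOf S) Set.univ S0) {x y : S}
    (hx : x ∈ S0) (hy : y ∈ S0) : x * y ∈ S0 :=
  T.mul_mem x hx y hy

lemma o_eq (T : InverseTransversalOn (mulOf S) Set.univ S0) {x u : S} (hu : u ∈ S0)
    (h₁ : x * u * x = x) (h₂ : u * x * u = u) : T.o x = u :=
  (T.o_unique x trivial u hu h₁ h₂).symm

lemma o_o (T : InverseTransversalOn (mulOf S) Set.univ S0) {x : S} (hx : x ∈ S0) :
    T.o (T.o x) = x :=
  T.o_eq hx (T.o_mul_o x) (T.mul_o_mul x)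

lemma o_mul_oo (T : InverseTransversalOn (mulOf S) Set.univ S0) (x : S) :
    T.o x * T.o (T.o x) * T.o x = T.o x :=
  T.mul_o_mul _

lemma oo_mul_o (T : InverseTransversalOn (mulOf S) Set.univ S0) (x : S) :
    T.o (T.o x) * T.o x * T.o (T.o x) = T.o (T.o x) :=
  T.o_mul_o _

/-- In a left inverse semigroup, `x⁰x = x⁰x⁰⁰`. -/
lemma o_mul_self_of_leftInverse (T : InverseTransversalOn (mulOf S) Set.univ S0)
    (hS : LeftInverseSgpOn (mulOf S) Set.univ) (x : S) :
    T.o x * x = T.o x * T.o (T.o x) := by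
  have h₁ := T.mul_o_mul x
  have h₂ := T.o_mul_o x
  have h₃ := T.o_mul_oo x
  have h₄ := T.oo_mul_o x
  refine hS.2 _ trivial _ trivial ?_ ?_
    ⟨Or.inr ⟨T.o x * x, trivial, ?_⟩, Or.inr ⟨T.o x * T.o (T.o x), trivial, ?_⟩⟩ <;>
  simp only [mulOf, Idem] <;> grind

/-- In a right inverse semigroup, `xx⁰ = x⁰⁰x⁰`. -/
lemma self_mul_o_of_rightInverse (T : InverseTransversalOn (mulOf S) Set.univ S0)
    (hS : RightInverseSgpOn (mulOf S) Set.univ) (x : S) :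
    x * T.o x = T.o (T.o x) * T.o x := by
  have h₁ := T.mul_o_mul x
  have h₂ := T.o_mul_o x
  have h₃ := T.o_mul_oo x
  have h₄ := T.oo_mul_o x
  refine hS.2 _ trivial _ trivial ?_ ?_
    ⟨Or.inr ⟨x * T.o x, trivial, ?_⟩, Or.inr ⟨T.o (T.o x) * T.o x, trivial, ?_⟩⟩ <;>
  simp only [mulOf, Idem] <;> grind

lemma o_mul_self_of_mem_LsetI (T : InverseTransversalOn (mulOf S) Set.univ S0) {x : S}
    (hx : x ∈ T.LsetI) : T.o x * x = T.o x * T.o (T.o x) := by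
  have h₁ := T.mul_o_mul x
  have h₂ := T.o_mul_o x
  have h₃ := T.o_mul_oo x
  have h₄ := T.oo_mul_o x
  have h := T.idem_comm _ hx.2.1 _ (T.mul_mem' (T.o_mem' x) (T.o_mem' (T.o x))) hx.2.2
    (by simp only [mulOf, Idem]; grind)
  simp only [mulOf] at h
  grind

lemma self_mul_o_of_mem_RsetI (T : InverseTransversalOn (mulOf S) Set.univ S0) {x : S}
    (hx : x ∈ T.RsetI) : x * T.o x = T.o (T.o x) * T.o x := by
  have h₁ := T.mul_o_mul x
  have h₂ := T.o_mul_o x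
  have h₃ := T.o_mul_oo x
  have h₄ := T.oo_mul_o x
  have h := T.idem_comm _ hx.2.1 _ (T.mul_mem' (T.o_mem' (T.o x)) (T.o_mem' x)) hx.2.2
    (by simp only [mulOf, Idem]; grind)
  simp only [mulOf] at h
  grind

lemma mul_mem_of_quasiIdeal (T : InverseTransversalOn (mulOf S) Set.univ S0)
    (hQ : QuasiIdealOn (mulOf S) Set.univ S0) {a x : S} (ha : a ∈ T.RsetI)
    (hx : x ∈ T.LsetI) : a * x ∈ S0 := by
  have h₁ := T.mul_o_mul x
  have h₂ := T.mul_o_mul a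
  have h₃ := T.o_mul_self_of_mem_LsetI hx
  have h₄ := T.self_mul_o_of_mem_RsetI ha
  have h := hQ _ (T.mul_mem' (T.o_mem' (T.o a)) (T.o_mem' a)) (a * x) trivial _
    (T.mul_mem' (T.o_mem' x) (T.o_mem' (T.o x)))
  simp only [mulOf] at h
  convert h using 1
  grind

/-- With `w = x⁰xyy⁰ ∈ S⁰`, one has `(xy)⁰ = y⁰w⁰x⁰`. -/
lemma o_mul (T : InverseTransversalOn (mulOf S) Set.univ S0) (x y : S) :
    T.o (x * y) = T.o y * T.o (T.o x * (x * y) * T.o y) * T.o x := by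
  have h₁ := T.mul_o_mul x
  have h₂ := T.o_mul_o x
  have h₃ := T.mul_o_mul y
  have h₄ := T.o_mul_o y
  have h₅ := T.mul_o_mul (T.o x * (x * y) * T.o y)
  have h₆ := T.o_mul_o (T.o x * (x * y) * T.o y)
  refine T.o_eq (T.mul_mem' (T.mul_mem' (T.o_mem' _) (T.o_mem' _)) (T.o_mem' _)) ?_ ?_ <;>
  generalize T.o (T.o x * (x * y) * T.o y) = v at * <;> grind

/-- `(xy)⁰⁰ = x⁰⁰wy⁰⁰` for `w = x⁰xyy⁰`. -/
lemma oo_mul (T : InverseTransversalOn (mulOf S) Set.univ S0)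
    (hQ : QuasiIdealOn (mulOf S) Set.univ S0) (x y : S) :
    T.o (T.o (x * y)) = T.o (T.o x) * (T.o x * (x * y) * T.o y) * T.o (T.o y) := by
  have hw : T.o x * (x * y) * T.o y ∈ S0 := hQ _ (T.o_mem' x) (x * y) trivial _ (T.o_mem' y)
  have h₁ := T.o_mul_oo x
  have h₂ := T.oo_mul_o x
  have h₃ := T.o_mul_oo y
  have h₄ := T.oo_mul_o y
  have h₅ := T.mul_o_mul (T.o x * (x * y) * T.o y)
  have h₆ := T.o_mul_o (T.o x * (x * y) * T.o y)
  have h₇ : T.o x * T.o (T.o x) * (T.o x * (x * y) * T.o y) = T.o x * (x * y) * T.o y := by grind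
  have h₈ : (T.o x * (x * y) * T.o y) * T.o (T.o y) * T.o y = T.o x * (x * y) * T.o y := by grind
  rw [T.o_mul x y]
  refine T.o_eq (T.mul_mem' (T.mul_mem' (T.o_mem' _) hw) (T.o_mem' _)) ?_ ?_ <;>
  generalize T.o (T.o x * (x * y) * T.o y) = v at * <;>
  generalize T.o x * (x * y) * T.o y = w at * <;> grind

lemma o_left (T : InverseTransversalOn (mulOf S) Set.univ S0) (x : S) :
    T.o (x * T.o x * T.o (T.o x)) = T.o x := by
  have h₁ := T.mul_o_mul x
  have h₂ := T.o_mul_o x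
  have h₃ := T.o_mul_oo x
  have h₄ := T.oo_mul_o x
  refine T.o_eq (T.o_mem' x) ?_ ?_ <;> grind

lemma o_right (T : InverseTransversalOn (mulOf S) Set.univ S0) (x : S) :
    T.o (T.o (T.o x) * T.o x * x) = T.o x := by
  have h₁ := T.mul_o_mul x
  have h₂ := T.o_mul_o x
  have h₃ := T.o_mul_oo x
  have h₄ := T.oo_mul_o x
  refine T.o_eq (T.o_mem' x) ?_ ?_ <;> grind

lemma left_mem_LsetI (T : InverseTransversalOn (mulOf S) Set.univ S0) (x : S) :
    x * T.o x * T.o (T.o x) ∈ T.LsetI := by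
  have h₂ := T.o_mul_o x
  have h₃ := T.o_mul_oo x
  have e : T.o x * (x * T.o x * T.o (T.o x)) = T.o x * T.o (T.o x) := by grind
  refine ⟨trivial, ?_, ?_⟩
  · simp only [mulOf, o_left, e]
    exact T.mul_mem' (T.o_mem' _) (T.o_mem' _)
  · simp only [mulOf, Idem, o_left, e]
    grind

lemma right_mem_RsetI (T : InverseTransversalOn (mulOf S) Set.univ S0) (x : S) :
    T.o (T.o x) * T.o x * x ∈ T.RsetI := by
  have h₂ := T.o_mul_o x
  have h₃ := T.o_mul_oo x
  have e : (T.o (T.o x) * T.o x * x) * T.o x = T.o (T.o x) * T.o x := by grind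
  refine ⟨trivial, ?_, ?_⟩
  · simp only [mulOf, o_right, e]
    exact T.mul_mem' (T.o_mem' _) (T.o_mem' _)
  · simp only [mulOf, Idem, o_right, e]
    grind

/-- A regular semigroup with a quasi-ideal inverse transversal is isomorphic to its
spined product, via `x ↦ (xx⁰x⁰⁰, x⁰⁰x⁰x)`. -/
lemma isoOn_invSpSet (T : InverseTransversalOn (mulOf S) Set.univ S0)
    (hQ : QuasiIdealOn (mulOf S) Set.univ S0) :
    IsoOn (mulOf S) (invSpMul T) Set.univ (invSpSet T) := by
  refine ⟨fun x => (x * T.o x * T.o (T.o x), T.o (T.o x) * T.o x * x),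
    ⟨?_, ?_, ?_⟩, ?_⟩
  · intro x _
    exact ⟨T.left_mem_LsetI x, T.right_mem_RsetI x, by simp only [o_left, o_right]⟩
  · intro x _ y _ h
    obtain ⟨h₁, h₂⟩ := Prod.mk.inj h
    have h₀ : T.o x = T.o y := by rw [← T.o_left x, h₁, T.o_left]
    have key : ∀ z : S, z * T.o z * T.o (T.o z) * T.o z * (T.o (T.o z) * T.o z * z) = z := by
      intro z
      have := T.mul_o_mul z
      have := T.o_mul_oo z
      grind
    rw [← key x, ← key y, h₁, h₂, h₀]
  · rintro ⟨x, a⟩ ⟨hx, ha, h⟩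
    simp only at hx ha h
    have h₁ := T.mul_o_mul x
    have h₂ := T.o_mul_o x
    have h₃ := T.mul_o_mul a
    have h₄ := T.o_mul_o a
    have h₅ := T.o_mul_self_of_mem_LsetI hx
    have h₆ := T.self_mul_o_of_mem_RsetI ha
    rw [← h] at h₃ h₄ h₆
    have hz : T.o (x * T.o x * a) = T.o x := by
      refine T.o_eq (T.o_mem' x) ?_ ?_ <;> grind
    refine ⟨x * T.o x * a, trivial, ?_⟩
    simp only [hz, Prod.mk.injEq]
    constructor <;> grind
  · intro x _ y _
    have h₁ := T.mul_o_mul x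
    have h₂ := T.o_mul_o x
    have h₃ := T.mul_o_mul y
    have h₄ := T.o_mul_o y
    have h₅ := T.o_mul_oo x
    have h₆ := T.o_mul_oo y
    have h₇ := T.mul_o_mul (T.o x * (x * y) * T.o y)
    simp only [mulOf, invSpMul, o_left, o_right, Prod.mk.injEq]
    rw [T.oo_mul hQ x y, T.o_mul x y]
    generalize T.o (T.o x * (x * y) * T.o y) = v at *
    generalize T.o (T.o x) = x2 at *
    generalize T.o (T.o y) = y2 at *
    constructor <;> grind

end InverseTransversalOn

/-- The data of a common inverse transversal `G` of `L` and `R`, in terms of the maps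
`p : x ↦ x⁰`, `q : a ↦ a⁰` with values in `G`, the inversion `inv` of `G`, and the
operation `st : R × L → G`. -/
structure CommonTransversal {L R G : Type*} [Semigroup L] [Semigroup R] [Semigroup G]
    (jL : G → L) (jR : G → R) (p : L → G) (q : R → G) (inv : G → G) (st : R → L → G) :
    Prop where
  injL : Function.Injective jL
  injR : Function.Injective jR
  mapL : ∀ s t, jL (s * t) = jL s * jL t
  mapR : ∀ s t, jR (s * t) = jR s * jR t
  mul_inv_mul : ∀ s, s * inv s * s = s
  inv_mul_inv : ∀ s, inv s * s * inv s = inv s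
  inv_inv : ∀ s, inv (inv s) = s
  idem_comm : ∀ s t : G, s * s = s → t * t = t → s * t = t * s
  p_jL : ∀ s, p (jL s) = inv s
  q_jR : ∀ s, q (jR s) = inv s
  mul_p_mul : ∀ x, x * jL (p x) * x = x
  p_mul : ∀ x, jL (p x) * x = jL (p x) * jL (inv (p x))
  p_eq : ∀ x u, x * jL u * x = x → jL u * x * jL u = jL u → p x = u
  mul_q_mul : ∀ a, a * jR (q a) * a = a
  mul_q : ∀ a, a * jR (q a) = jR (inv (q a)) * jR (q a)
  q_eq : ∀ a u, a * jR u * a = a → jR u * a * jR u = jR u → q a = u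
  st_st : ∀ y z a b, p y = q b →
    st (jR (st a y) * (jR (q b) * b)) z = st a (y * jL (p y) * jL (st b z))
  st_left : ∀ s x, jL (st (jR s) x) = jL s * x
  st_right : ∀ a s, jR (st a (jL s)) = a * jR s

/-- The spined product `{(x,a) : x⁰ = a⁰}`. -/
def spinedSet {L R G : Type*} (p : L → G) (q : R → G) : Set (L × R) :=
  {z | p z.1 = q z.2}

/-- The multiplication `(x,a)(y,b) = (xx⁰(a∗y), (a∗y)b⁰b)`. -/
def spinedMul {L R G : Type*} [Semigroup L] [Semigroup R] (jL : G → L) (jR : G → R)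
    (p : L → G) (q : R → G) (st : R → L → G) (z w : L × R) : L × R :=
  (z.1 * jL (p z.1) * jL (st z.2 w.1), jR (st z.2 w.1) * (jR (q w.2) * w.2))

namespace CommonTransversal

variable {L R G : Type*} [Semigroup L] [Semigroup R] [Semigroup G]
  {jL : G → L} {jR : G → R} {p : L → G} {q : R → G} {inv : G → G} {st : R → L → G}

lemma st_jR_jL (C : CommonTransversal jL jR p q inv st) (s t : G) :
    st (jR s) (jL t) = s * t :=
  C.injL (by rw [C.st_left, C.mapL])

lemma inv_q_mul_q_mul (C : CommonTransversal jL jR p q inv st) (a : R) :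
    jR (inv (q a)) * jR (q a) * a = a := by
  rw [← C.mul_q, C.mul_q_mul]

lemma mul_p_mul_inv_p (C : CommonTransversal jL jR p q inv st) (x : L) :
    x * (jL (p x) * jL (inv (p x))) = x := by
  rw [← C.p_mul, ← mul_assoc, C.mul_p_mul]

lemma st_mul_left_aux (C : CommonTransversal jL jR p q inv st) (s : G) (b : R) (z : L) :
    st (jR s * b) z = s * inv (q b) * q b * st b z := by
  have h := C.st_st (jL (inv (q b))) z (jR s) b (by rw [C.p_jL, C.inv_inv])
  have hb := C.inv_q_mul_q_mul b
  rw [C.st_jR_jL, C.p_jL, C.inv_inv, ← C.mapL, ← C.mapL, C.st_jR_jL, C.mapR] at h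
  have e : jR s * jR (inv (q b)) * (jR (q b) * b) = jR s * b := by grind
  rw [e] at h
  rw [h]
  simp only [mul_assoc]

lemma inv_q_mul_q_mul_st (C : CommonTransversal jL jR p q inv st) (b : R) (z : L) :
    inv (q b) * q b * st b z = st b z := by
  have h := C.st_mul_left_aux (inv (q b) * q b) b z
  rw [C.mapR, C.inv_q_mul_q_mul] at h
  have := C.inv_mul_inv (q b)
  grind

lemma st_mul_left (C : CommonTransversal jL jR p q inv st) (s : G) (b : R) (z : L) :
    st (jR s * b) z = s * st b z := by
  have h := C.st_mul_left_aux s b z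
  have := C.inv_q_mul_q_mul_st b z
  grind

lemma st_mul_right_aux (C : CommonTransversal jL jR p q inv st) (a : R) (y : L) (s : G) :
    st a (y * jL s) = st a y * (p y * inv (p y) * s) := by
  have h := C.st_st y (jL s) a (jR (inv (p y))) (by rw [C.q_jR, C.inv_inv])
  have hy := C.mul_p_mul_inv_p y
  rw [C.st_jR_jL, C.q_jR, C.inv_inv, ← C.mapR, ← C.mapR, C.st_jR_jL, C.mapL] at h
  have e : y * jL (p y) * (jL (inv (p y)) * jL s) = y * jL s := by grind
  rw [e] at h
  rw [← h]
  simp only [mul_assoc]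

lemma st_mul_p_mul_inv_p (C : CommonTransversal jL jR p q inv st) (a : R) (y : L) :
    st a y * (p y * inv (p y)) = st a y := by
  have h := C.st_mul_right_aux a y (p y * inv (p y))
  rw [C.mapL, C.mul_p_mul_inv_p] at h
  have := C.mul_inv_mul (p y)
  grind

lemma st_mul_right (C : CommonTransversal jL jR p q inv st) (a : R) (y : L) (s : G) :
    st a (y * jL s) = st a y * s := by
  have h := C.st_mul_right_aux a y s
  have := C.st_mul_p_mul_inv_p a y
  grind

lemma inv_mul_inv_mul (C : CommonTransversal jL jR p q inv st) {u t : G}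
    (h : inv u * u * t = t) : inv t * (inv u * u) = inv t := by
  have h₁ := C.inv_mul_inv t
  have h₂ := C.inv_mul_inv u
  have h₃ := C.idem_comm (inv u * u) (t * inv t) (by grind) (by grind)
  grind

lemma mul_inv_mul_inv (C : CommonTransversal jL jR p q inv st) {u t : G}
    (h : t * (u * inv u) = t) : u * inv u * inv t = inv t := by
  have h₁ := C.inv_mul_inv t
  have h₂ := C.mul_inv_mul u
  have h₃ := C.idem_comm (u * inv u) (inv t * t) (by grind) (by grind)
  grind

lemma p_left (C : CommonTransversal jL jR p q inv st) {x : L} {t : G}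
    (h : inv (p x) * p x * t = t) : p (x * jL (p x) * jL t) = inv t := by
  have h₁ := C.mul_p_mul x
  have h₂ := C.p_mul x
  have h₃ := congrArg jL h
  have h₇ := congrArg jL (C.inv_mul_inv_mul h)
  have h₄ := congrArg jL (C.mul_inv_mul t)
  have h₅ := congrArg jL (C.inv_mul_inv t)
  have h₆ := congrArg jL (C.mul_inv_mul (p x))
  simp only [C.mapL] at h₃ h₄ h₅ h₆ h₇
  apply C.p_eq <;> grind

lemma q_right (C : CommonTransversal jL jR p q inv st) {b : R} {t : G}
    (h : t * (q b * inv (q b)) = t) : q (jR t * (jR (q b) * b)) = inv t := by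
  have h₁ := C.mul_q_mul b
  have h₂ := C.mul_q b
  have h₃ := congrArg jR h
  have h₇ := congrArg jR (C.mul_inv_mul_inv h)
  have h₄ := congrArg jR (C.mul_inv_mul t)
  have h₅ := congrArg jR (C.inv_mul_inv t)
  have h₆ := congrArg jR (C.mul_inv_mul (q b))
  simp only [C.mapR] at h₃ h₄ h₅ h₆ h₇
  apply C.q_eq <;> grind

lemma p_mul_fst (C : CommonTransversal jL jR p q inv st) {x : L} {a : R} (h : p x = q a)
    (y : L) : p (x * jL (p x) * jL (st a y)) = inv (st a y) :=
  C.p_left (by rw [h, C.inv_q_mul_q_mul_st])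

lemma q_mul_snd (C : CommonTransversal jL jR p q inv st) {y : L} {b : R} (h : p y = q b)
    (a : R) : q (jR (st a y) * (jR (q b) * b)) = inv (st a y) :=
  C.q_right (by rw [← h, C.st_mul_p_mul_inv_p])

lemma semigroupOn (C : CommonTransversal jL jR p q inv st) :
    SemigroupOn (spinedMul jL jR p q st) (spinedSet p q) := by
  refine ⟨?_, ?_⟩
  · rintro ⟨x, a⟩ hx ⟨y, b⟩ hy
    exact (C.p_mul_fst hx y).trans (C.q_mul_snd hy a).symm
  · rintro ⟨x, a⟩ hx ⟨y, b⟩ hy ⟨z, c⟩ hz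
    simp only [spinedSet, Set.mem_ofPred_eq] at hx hy hz
    simp only [spinedMul, C.p_mul_fst hx, C.q_mul_snd hz, Prod.mk.injEq]
    have h := C.st_st y z a b hy
    have h₁ := C.st_mul_left (st a y) (jR (q b) * b) z
    have h₂ := C.st_mul_right a (y * jL (p y)) (st b z)
    have h₃ := C.mul_inv_mul (st a y)
    have h₄ := C.mul_inv_mul (st b z)
    rw [← h]
    rw [← h] at h₂
    generalize st (jR (st a y) * (jR (q b) * b)) z = w at *
    have h₅ : st a y * inv (st a y) * w = w := by grind
    have h₆ : w * inv (st b z) * st b z = w := by grind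
    have h₇ := congrArg jL h₅
    have h₈ := congrArg jR h₆
    simp only [C.mapL] at h₇
    simp only [C.mapR] at h₈
    constructor <;> grind

lemma st_jL_of_eq (C : CommonTransversal jL jR p q inv st) (a : R) :
    st a (jL (q a)) = inv (q a) * q a :=
  C.injR (by rw [C.st_right, C.mul_q, C.mapR])

lemma st_jR_of_eq (C : CommonTransversal jL jR p q inv st) (x : L) :
    st (jR (p x)) x = p x * inv (p x) :=
  C.injL (by rw [C.st_left, C.p_mul, C.mapL])

lemma diag_mul (C : CommonTransversal jL jR p q inv st) (u : G) (x : L) (a : R) :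
    spinedMul jL jR p q st (jL u, jR u) (x, a) =
      (jL (st (jR u) x), jR (st (jR u) x) * (jR (q a) * a)) := by
  have h := congrArg jL (C.mul_inv_mul u)
  simp only [C.mapL] at h
  simp only [spinedMul, C.p_jL, C.st_left, Prod.mk.injEq, and_true]
  grind

lemma mul_diag (C : CommonTransversal jL jR p q inv st) (u : G) (x : L) (a : R) :
    spinedMul jL jR p q st (x, a) (jL u, jR u) =
      (x * jL (p x) * jL (st a (jL u)), jR (st a (jL u))) := by
  have h := congrArg jR (C.mul_inv_mul u)
  simp only [C.mapR] at h
  simp only [spinedMul, C.q_jR, C.st_right, Prod.mk.injEq, true_and]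
  grind

lemma diag_mul_diag (C : CommonTransversal jL jR p q inv st) (u v : G) :
    spinedMul jL jR p q st (jL u, jR u) (jL v, jR v) = (jL (u * v), jR (u * v)) := by
  have h := congrArg jL (C.mul_inv_mul u)
  simp only [C.mapL] at h
  rw [C.mul_diag, C.st_jR_jL, C.p_jL, Prod.mk.injEq]
  simp only [C.mapL, and_true]
  grind

lemma mul_diag_mul (C : CommonTransversal jL jR p q inv st) {x : L} {a : R} (h : p x = q a)
    (u : G) : spinedMul jL jR p q st (spinedMul jL jR p q st (x, a) (jL u, jR u)) (x, a) =
      (x * jL (p x) * (jL (st a (jL u)) * x),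
        jR (st (jR (st a (jL u))) x) * (jR (q a) * a)) := by
  have h₁ := congrArg jL (C.mul_inv_mul (st a (jL u)))
  simp only [C.mapL] at h₁
  rw [C.mul_diag]
  simp only [spinedMul, C.p_mul_fst h, C.st_left, Prod.mk.injEq, and_true]
  grind

lemma diag_mul_mul_diag (C : CommonTransversal jL jR p q inv st) (x : L) (a : R) (u v : G) :
    spinedMul jL jR p q st (spinedMul jL jR p q st (jL u, jR u) (x, a)) (jL v, jR v) =
      (jL (st (jR u) x * st (jR (q a) * a) (jL v)),
        jR (st (jR u) x * st (jR (q a) * a) (jL v))) := by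
  have h₁ := congrArg jL (C.mul_inv_mul (st (jR u) x))
  simp only [C.mapL] at h₁
  rw [C.diag_mul, C.mul_diag, C.st_mul_left, C.p_jL, Prod.mk.injEq]
  simp only [C.mapL, and_true]
  grind

lemma mul_o_mul (C : CommonTransversal jL jR p q inv st) {x : L} {a : R} (h : p x = q a) :
    spinedMul jL jR p q st (spinedMul jL jR p q st (x, a) (jL (p x), jR (p x))) (x, a) =
      (x, a) := by
  have h₁ := C.inv_mul_inv (p x)
  have h₂ := C.mul_p_mul_inv_p x
  have h₃ := C.mul_p_mul x
  have h₄ := C.inv_q_mul_q_mul a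
  have h₅ := congrArg jL (C.mul_inv_mul (p x))
  have h₆ := C.st_jL_of_eq a
  have h₇ := C.st_mul_left (inv (p x)) (jR (p x)) x
  rw [C.st_jR_of_eq, ← mul_assoc, h₁, ← C.mapR] at h₇
  rw [C.mul_diag_mul h]
  rw [← h] at h₄ h₆ ⊢
  rw [h₆, h₇, Prod.mk.injEq]
  simp only [C.mapL] at h₅ ⊢
  constructor <;> grind

lemma o_mul_o (C : CommonTransversal jL jR p q inv st) {x : L} {a : R} (h : p x = q a) :
    spinedMul jL jR p q st (spinedMul jL jR p q st (jL (p x), jR (p x)) (x, a))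
      (jL (p x), jR (p x)) = (jL (p x), jR (p x)) := by
  have h₁ := C.st_jL_of_eq a
  have h₂ := C.mul_inv_mul (p x)
  have e : p x * inv (p x) * (p x * (inv (p x) * p x)) = p x := by grind
  rw [C.diag_mul_mul_diag, C.st_mul_left, C.st_jR_of_eq]
  rw [← h] at h₁ ⊢
  rw [h₁, e]

lemma eq_o (C : CommonTransversal jL jR p q inv st) {x : L} {a : R} (h : p x = q a) {u : G}
    (hu₁ : spinedMul jL jR p q st (spinedMul jL jR p q st (x, a) (jL u, jR u)) (x, a) = (x, a))
    (hu₂ : spinedMul jL jR p q st (spinedMul jL jR p q st (jL u, jR u) (x, a)) (jL u, jR u) =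
      (jL u, jR u)) : u = p x := by
  rw [C.mul_diag_mul h] at hu₁
  rw [C.diag_mul_mul_diag, C.st_mul_left] at hu₂
  obtain ⟨k₁, k₂⟩ := Prod.mk.inj hu₁
  have k₃ := C.injL (Prod.mk.inj hu₂).1
  have hα := C.inv_q_mul_q_mul_st a (jL u)
  have hαR := C.st_right a u
  have hγL := C.st_left (st a (jL u)) x
  have hγ : st (jR (st a (jL u))) x = st a (jL (st (jR u) x)) := by
    have e := C.st_st (jL u) x a (jR u) (by rw [C.p_jL, C.q_jR])
    have e₁ := congrArg jR (C.mul_inv_mul u)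
    have e₂ := congrArg jL (C.mul_inv_mul u)
    simp only [C.mapR] at e₁
    simp only [C.mapL] at e₂
    have e₃ : jR (st a (jL u)) * (jR (inv u) * jR u) = jR (st a (jL u)) := by grind
    have e₄ : jL u * jL (inv u) * jL (st (jR u) x) = jL (st (jR u) x) := by
      rw [C.st_left]; grind
    rwa [C.q_jR, C.p_jL, e₃, e₄] at e
  have hγR := C.st_right a (st (jR u) x)
  have hx := C.p_mul x
  have ha := C.mul_q a
  have hs := C.mul_inv_mul (p x)
  have hs' := C.inv_mul_inv (p x)
  have hsL := congrArg jL hs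
  have hsR := congrArg jR hs
  have hxx := C.mul_p_mul_inv_p x
  rw [← h] at hα ha k₂ k₃
  rw [← hγ] at hγR
  generalize st (jR (st a (jL u))) x = c at *
  generalize st a (jL u) = α at *
  generalize st (jR u) x = β at *
  have hc : c = inv (p x) := by
    have e₁ : p x * c = p x * inv (p x) := by
      apply C.injL
      simp only [C.mapL] at hsL ⊢
      grind
    have e₂ : inv (p x) * p x * c = c := by
      apply C.injL
      have := congrArg jL hα
      simp only [C.mapL] at this ⊢
      grind
    grind
  have e₁ : p x = p x * α := by
    apply C.p_eq <;> simp only [C.mapL] at hsL ⊢ <;> grind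
  have e₂ : q a = β * p x := by
    apply C.q_eq <;> simp only [C.mapR] at hsR ⊢ <;> grind
  grind

end CommonTransversal

lemma exists_commonTransversal {L R G : Type*} [Semigroup L] [Semigroup R] [Semigroup G]
    {jL : G → L} {jR : G → R}
    (hjL : Function.Injective jL) (hjR : Function.Injective jR)
    (hjLm : ∀ s t : G, jL (s * t) = jL s * jL t)
    (hjRm : ∀ s t : G, jR (s * t) = jR s * jR t)
    (hG : InverseSgpOn (mulOf G) Set.univ)
    (hL : LeftInverseSgpOn (mulOf L) Set.univ)
    (hR : RightInverseSgpOn (mulOf R) Set.univ)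
    (TL : InverseTransversalOn (mulOf L) Set.univ (Set.range jL))
    (TR : InverseTransversalOn (mulOf R) Set.univ (Set.range jR))
    (st : R → L → G)
    (cond1 : ∀ (y z : L) (a b : R),
      (∃ s : G, jL s = TL.o y ∧ jR s = TR.o b) →
      st (jR (st a y) * (TR.o b * b)) z = st a ((y * TL.o y) * jL (st b z)))
    (cond2L : ∀ (s : G) (x : L), jL (st (jR s) x) = jL s * x)
    (cond2R : ∀ (a : R) (s : G), jR (st a (jL s)) = a * jR s) :
    ∃ (p : L → G) (q : R → G) (inv : G → G), (∀ x, jL (p x) = TL.o x) ∧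
      (∀ a, jR (q a) = TR.o a) ∧ CommonTransversal jL jR p q inv st := by
  choose p hp using fun x => TL.o_mem' x
  choose q hq using fun a => TR.o_mem' a
  have h₁ : ∀ s, s * p (jL s) * s = s := fun s =>
    hjL (by rw [hjLm, hjLm, hp, TL.mul_o_mul])
  have h₂ : ∀ s, p (jL s) * s * p (jL s) = p (jL s) := fun s =>
    hjL (by rw [hjLm, hjLm, hp, TL.o_mul_o])
  have hpe : ∀ x u, x * jL u * x = x → jL u * x * jL u = jL u → p x = u := fun x u e f =>
    hjL (by rw [hp, TL.o_eq ⟨u, rfl⟩ e f])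
  have hqe : ∀ a u, a * jR u * a = a → jR u * a * jR u = jR u → q a = u := fun a u e f =>
    hjR (by rw [hq, TR.o_eq ⟨u, rfl⟩ e f])
  have hqR : ∀ s, q (jR s) = p (jL s) := fun s => hqe _ _
    (by rw [← hjRm, ← hjRm, h₁]) (by rw [← hjRm, ← hjRm, h₂])
  refine ⟨p, q, fun s => p (jL s), hp, hq, ?_⟩
  exact
    { injL := hjL
      injR := hjR
      mapL := hjLm
      mapR := hjRm
      mul_inv_mul := h₁
      inv_mul_inv := h₂
      inv_inv := fun s => hjL (by rw [hp, hp, TL.o_o ⟨s, rfl⟩])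
      idem_comm := fun s t hs ht => hG.2 s trivial t trivial hs ht
      p_jL := fun _ => rfl
      q_jR := hqR
      mul_p_mul := fun x => by rw [hp, TL.mul_o_mul]
      p_mul := fun x => by rw [hp, hp, TL.o_mul_self_of_leftInverse hL]
      p_eq := hpe
      mul_q_mul := fun a => by rw [hq, TR.mul_o_mul]
      mul_q := fun a => by rw [← hqR, hq, hq, TR.self_mul_o_of_rightInverse hR]
      q_eq := hqe
      st_st := fun y z a b h => by
        rw [hq, hp]
        exact cond1 y z a b ⟨p y, hp y, by rw [h, hq]⟩
      st_left := cond2L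
      st_right := cond2R }

end Paper

open Paper in
/-- **Theorem `regular-theorem`.** Let `S⁰` (the inverse semigroup
`G`) be a common quasi-ideal inverse transversal of a left inverse semigroup `L`
and a right inverse semigroup `R`, and let `∗ : R × L → S⁰` satisfy (1) and (2).
Then `T = {(x,a) : x⁰ = a⁰}` with `(x,a)(y,b) = (xx⁰(a∗y), (a∗y)b⁰b)` is a
regular semigroup with `T⁰ = {(s,s)}` a quasi-ideal inverse transversal
isomorphic to `S⁰`.  Conversely every regular semigroup with a quasi-ideal
inverse transversal arises this way (with `L = {x : x⁰x ∈ E⁰}`,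
`R = {x : xx⁰ ∈ E⁰}` and `a∗x = ax`). -/
theorem stmt17 {L R G : Type u} [Semigroup L] [Semigroup R] [Semigroup G]
    (jL : G → L) (jR : G → R)
    (hjL : Function.Injective jL) (hjR : Function.Injective jR)
    (hjLm : ∀ s t : G, jL (s * t) = jL s * jL t)
    (hjRm : ∀ s t : G, jR (s * t) = jR s * jR t)
    (hG : InverseSgpOn (mulOf G) Set.univ)
    (hL : LeftInverseSgpOn (mulOf L) Set.univ)
    (hR : RightInverseSgpOn (mulOf R) Set.univ)
    (TL : InverseTransversalOn (mulOf L) Set.univ (Set.range jL))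
    (TR : InverseTransversalOn (mulOf R) Set.univ (Set.range jR))
    (hQL : QuasiIdealOn (mulOf L) Set.univ (Set.range jL))
    (hQR : QuasiIdealOn (mulOf R) Set.univ (Set.range jR))
    (st : R → L → G)
    (cond1 : ∀ (y z : L) (a b : R),
      (∃ s : G, jL s = TL.o y ∧ jR s = TR.o b) →
      st (jR (st a y) * (TR.o b * b)) z = st a ((y * TL.o y) * jL (st b z)))
    (cond2L : ∀ (s : G) (x : L), jL (st (jR s) x) = jL s * x)
    (cond2R : ∀ (a : R) (s : G), jR (st a (jL s)) = a * jR s)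
    :
    (SemigroupOn (invAbsMul TL TR st) (invAbsTset TL TR) ∧
     RegularOn (invAbsMul TL TR st) (invAbsTset TL TR) ∧
     Nonempty (InverseTransversalOn (invAbsMul TL TR st) (invAbsTset TL TR) (absT0 jL jR)) ∧
     QuasiIdealOn (invAbsMul TL TR st) (invAbsTset TL TR) (absT0 jL jR) ∧
     IsoOn (mulOf G) (invAbsMul TL TR st) Set.univ (absT0 jL jR)) ∧
    (∀ (S : Type u) [Semigroup S] (S0 : Set S)
       (T : InverseTransversalOn (mulOf S) Set.univ S0),
       RegularOn (mulOf S) Set.univ → QuasiIdealOn (mulOf S) Set.univ S0 →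
       ((∀ y ∈ T.LsetI, ∀ z ∈ T.LsetI, ∀ a ∈ T.RsetI, ∀ b ∈ T.RsetI,
           T.o y = T.o b →
           (a * y) * (T.o b * b) * z = a * ((y * T.o y) * (b * z))) ∧
        (∀ a ∈ T.RsetI, ∀ x ∈ T.LsetI, a * x ∈ S0) ∧
        IsoOn (mulOf S) (invSpMul T) Set.univ (invSpSet T))) := by
  refine ⟨?_, fun S _ S0 T _ hQ => ⟨?_, ?_, T.isoOn_invSpSet hQ⟩⟩
  · obtain ⟨p, q, inv, hp, hq, C⟩ := exists_commonTransversal hjL hjR hjLm hjRm hG hL hR TL TR st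
      cond1 cond2L cond2R
    have hmul : invAbsMul TL TR st = spinedMul jL jR p q st := by
      funext z w
      simp only [invAbsMul, spinedMul, mulOf, hp, hq]
    have hset : invAbsTset TL TR = spinedSet p q := by
      ext ⟨x, a⟩
      simp only [invAbsTset, spinedSet, Set.mem_ofPred_eq, ← hp, ← hq]
      constructor
      · rintro ⟨s, h₁, h₂⟩
        rw [← hjL h₁, ← hjR h₂]
      · exact fun h => ⟨p x, rfl, by rw [h]⟩
    rw [hmul, hset]
    have hdiag : ∀ s, (jL s, jR s) ∈ spinedSet p q := fun s => by
      simp only [spinedSet, Set.mem_ofPred_eq, C.p_jL, C.q_jR]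
    refine ⟨C.semigroupOn, ?_, ⟨?_⟩, ?_, ?_⟩
    · rintro ⟨x, a⟩ h
      exact ⟨_, hdiag (p x), C.mul_o_mul h, C.o_mul_o h⟩
    · refine
        { sub := ?_
          mul_mem := ?_
          o := fun z => (jL (p z.1), jR (p z.1))
          o_mem := fun z _ => ⟨p z.1, rfl⟩
          o_inv1 := fun z hz => C.mul_o_mul hz
          o_inv2 := fun z hz => C.o_mul_o hz
          o_unique := ?_
          idem_comm := ?_ }
      · rintro _ ⟨s, rfl⟩
        exact hdiag s
      · rintro _ ⟨s, rfl⟩ _ ⟨t, rfl⟩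
        exact ⟨s * t, C.diag_mul_diag s t⟩
      · rintro ⟨x, a⟩ hx _ ⟨u, rfl⟩ h₁ h₂
        rw [C.eq_o hx h₁ h₂]
      · rintro _ ⟨s, rfl⟩ _ ⟨t, rfl⟩ hs ht
        rw [Idem, C.diag_mul_diag] at hs ht
        rw [C.diag_mul_diag, C.diag_mul_diag,
          C.idem_comm s t (hjL (Prod.mk.inj hs).1) (hjL (Prod.mk.inj ht).1)]
    · rintro _ ⟨s, rfl⟩ ⟨x, a⟩ _ _ ⟨t, rfl⟩
      exact ⟨_, C.diag_mul_mul_diag x a s t⟩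
    · refine ⟨fun s => (jL s, jR s), ⟨fun s _ => ⟨s, rfl⟩,
        fun s _ t _ h => hjL (Prod.mk.inj h).1, ?_⟩, fun s _ t _ => (C.diag_mul_diag s t).symm⟩
      rintro _ ⟨s, rfl⟩
      exact ⟨s, trivial, rfl⟩
  · intro y _ z _ a _ b _ h
    simp only [h, mul_assoc]
  · exact fun a ha x hx => T.mul_mem_of_quasiIdeal hQ ha hx
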